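/- Let K be a field containing a primitive 5th root of unity zeta. Consider 5-tuples (q0, q1, q2, q3, q4) of homogeneous quadratic forms in K[w0, w1, w2, w3, w4], with subscripts read modulo 5, satisfying for all i: (i) q_{i+1}(w0, w1, w2, w3, w4) = q_i(w1, w2, w3, w4, w0), and (ii) q_i(w0, zeta*w1, zeta^2*w2, zeta^3*w3, zeta^4*w4) = zeta^{2i} * q_i(w0, w1, w2, w3, w4). Then the set of such tuples is a 3-dimensional K-vector space, spanned by the three tuples given by q_i = w_i^2, q_i = w_{i+1}*w_{i+4}, and q_i = w_{i+2}*w_{i+3} (for i = 0, ..., 4, subscripts mod 5). -/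

import Mathlib

open MvPolynomial

lemma hiq_coeff_diag {K : Type*} [Field K] (c : ZMod 5 → K) (p : MvPolynomial (ZMod 5) K)
    (d : ZMod 5 →₀ ℕ) :
    coeff d (aeval (fun t : ZMod 5 => C (c t) * X t) p) =
      (d.prod fun t k => c t ^ k) * coeff d p := by
  induction p using MvPolynomial.induction_on' with
  | monomial u a =>
    have h : aeval (fun t : ZMod 5 => C (c t) * X t) (monomial u a) =
        monomial u ((u.prod fun t k => c t ^ k) * a) := by
      rw [aeval_monomial]
      simp only [mul_pow, Finsupp.prod_mul]
      rw [monomial_eq, C_mul]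
      simp only [Finsupp.prod, map_prod, C_pow, algebraMap_eq]
      ring
    rw [h, coeff_monomial, coeff_monomial]
    split_ifs with h1
    · rw [h1]
    · simp
  | add p q hp hq => rw [map_add, coeff_add, coeff_add, hp, hq, mul_add]

/-- The invariant tuple with parameters `r s t`. -/
noncomputable def hiqF {K : Type*} [Field K] (r s t : K) (i : ZMod 5) : MvPolynomial (ZMod 5) K :=
  C r * X i ^ 2 + C s * (X (i + 1) * X (i + 4)) + C t * (X (i + 2) * X (i + 3))

lemma hiq_coeffs {K : Type*} [Field K] (r s t : K) :
    coeff (Finsupp.single 0 1 + Finsupp.single 0 1) (hiqF r s t 0) = r ∧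
    coeff (Finsupp.single 1 1 + Finsupp.single 4 1) (hiqF r s t 0) = s ∧
    coeff (Finsupp.single 2 1 + Finsupp.single 3 1) (hiqF r s t 0) = t := by
  have e : hiqF r s t 0 = monomial (Finsupp.single 0 1 + Finsupp.single 0 1) r +
      monomial (Finsupp.single 1 1 + Finsupp.single 4 1) s +
      monomial (Finsupp.single 2 1 + Finsupp.single 3 1) t := by
    have key : ∀ (a b : ZMod 5) (x : K), monomial (Finsupp.single a 1 + Finsupp.single b 1) x =
        C x * (X a * X b) := by
      intro a b x
      rw [X, X, monomial_mul, C_mul_monomial]; simp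
    rw [key, key, key, hiqF]
    simp [pow_two]
  have n1 : (Finsupp.single 0 1 + Finsupp.single 0 1 : ZMod 5 →₀ ℕ) ≠
      Finsupp.single 1 1 + Finsupp.single 4 1 := by
    intro h
    have := DFunLike.congr_fun h 0
    simp [Finsupp.single_apply] at this
    revert this; decide
  have n2 : (Finsupp.single 0 1 + Finsupp.single 0 1 : ZMod 5 →₀ ℕ) ≠
      Finsupp.single 2 1 + Finsupp.single 3 1 := by
    intro h
    have := DFunLike.congr_fun h 0
    simp [Finsupp.single_apply] at this
    revert this; decide
  have n3 : (Finsupp.single 1 1 + Finsupp.single 4 1 : ZMod 5 →₀ ℕ) ≠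
      Finsupp.single 2 1 + Finsupp.single 3 1 := by
    intro h
    have := DFunLike.congr_fun h 1
    simp only [Finsupp.add_apply, Finsupp.single_apply] at this
    revert this; decide
  rw [e]
  simp only [coeff_add, coeff_monomial, n1, n2, n3, n1.symm, n2.symm, n3.symm, if_true, if_false,
    add_zero, zero_add, and_self]

lemma hiq_hom {K : Type*} [Field K] (r s t : K) (i : ZMod 5) :
    (hiqF r s t i).IsHomogeneous 2 := by
  have h : ∀ (x : K) (a b : ZMod 5), (C x * (X a * X b) : MvPolynomial (ZMod 5) K).IsHomogeneous 2 :=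
    fun x a b => ((isHomogeneous_X K a).mul (isHomogeneous_X K b)).C_mul x
  unfold hiqF
  rw [pow_two]
  exact ((h _ _ _).add (h _ _ _)).add (h _ _ _)

lemma hiq_shift {K : Type*} [Field K] (r s t : K) (i : ZMod 5) :
    hiqF r s t (i + 1) = aeval (fun t : ZMod 5 => X (t + 1)) (hiqF r s t i) := by
  simp [hiqF, algebraMap_eq, add_right_comm]

lemma hiq_pow {K : Type*} [Field K] (ζ : K) (hζ : IsPrimitiveRoot ζ 5) (a b : ZMod 5) :
    ζ ^ a.val * ζ ^ b.val = ζ ^ (a + b).val := by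
  rw [ZMod.val_add, ← pow_add, ← pow_mod_orderOf, ← hζ.eq_orderOf]

lemma hiq_diag {K : Type*} [Field K] (ζ : K) (hζ : IsPrimitiveRoot ζ 5) (r s t : K) (i : ZMod 5) :
    aeval (fun t : ZMod 5 => C (ζ ^ t.val) * X t) (hiqF r s t i) =
      C (ζ ^ ((2 * i : ZMod 5)).val) * hiqF r s t i := by
  have key : ∀ (x : K) (a b : ZMod 5), a + b = 2 * i →
      aeval (fun t : ZMod 5 => (C (ζ ^ t.val) * X t : MvPolynomial (ZMod 5) K))
        (C x * (X a * X b) : MvPolynomial (ZMod 5) K) =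
      C (ζ ^ ((2 * i : ZMod 5)).val) * (C x * (X a * X b)) := by
    intro x a b h
    rw [← h, ← hiq_pow ζ hζ]
    simp only [map_mul, aeval_X, aeval_C, algebraMap_eq]
    ring
  unfold hiqF
  rw [pow_two, map_add, map_add, key, key, key]
  · ring
  all_goals (clear key; revert i; decide)

lemma hiq_zero {K : Type*} [Field K] (ζ : K) (hζ : IsPrimitiveRoot ζ 5)
    (p : MvPolynomial (ZMod 5) K) (hp : p.IsHomogeneous 2)
    (hd : aeval (fun t : ZMod 5 => C (ζ ^ t.val) * X t) p = p)
    (h0 : coeff (Finsupp.single 0 1 + Finsupp.single 0 1) p = 0)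
    (h1 : coeff (Finsupp.single 1 1 + Finsupp.single 4 1) p = 0)
    (h2 : coeff (Finsupp.single 2 1 + Finsupp.single 3 1) p = 0) : p = 0 := by
  ext d
  rw [coeff_zero]
  by_cases hdeg : d.degree = 2
  · obtain ⟨a, b, rfl⟩ : ∃ a b : ZMod 5, d = Finsupp.single a 1 + Finsupp.single b 1 := by
      have hc : (Finsupp.toMultiset d).card = 2 := by
        rw [Finsupp.card_toMultiset, ← hdeg]; rfl
      obtain ⟨a, b, hab⟩ := Multiset.card_eq_two.1 hc
      refine ⟨a, b, Multiset.toFinsupp.symm.injective ?_⟩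
      change Finsupp.toMultiset d = Finsupp.toMultiset _
      rw [hab, map_add, Finsupp.toMultiset_single, Finsupp.toMultiset_single]
      simp [← Multiset.singleton_add]
    by_contra hne
    have hco := hiq_coeff_diag (fun t : ZMod 5 => ζ ^ t.val) p
      (Finsupp.single a 1 + Finsupp.single b 1)
    rw [hd, Finsupp.prod_add_index' (by simp) (by intros; rw [pow_add]),
      Finsupp.prod_single_index (by simp), Finsupp.prod_single_index (by simp), pow_one, pow_one,
      hiq_pow ζ hζ] at hco
    have h5 : ζ ^ (a + b).val = 1 := (mul_eq_right₀ hne).1 hco.symm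
    have hab : (a + b).val = 0 :=
      Nat.eq_zero_of_dvd_of_lt (hζ.dvd_of_pow_eq_one _ h5) (ZMod.val_lt _)
    have cases5 : (a = 0 ∧ b = 0) ∨ (a = 1 ∧ b = 4) ∨ (a = 4 ∧ b = 1) ∨ (a = 2 ∧ b = 3) ∨
        (a = 3 ∧ b = 2) := by
      clear * - hab
      revert a b; decide
    rcases cases5 with ⟨rfl, rfl⟩ | ⟨rfl, rfl⟩ | ⟨rfl, rfl⟩ | ⟨rfl, rfl⟩ | ⟨rfl, rfl⟩
    · exact hne h0
    · exact hne h1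
    · rw [add_comm] at hne; exact hne h1
    · exact hne h2
    · rw [add_comm] at hne; exact hne h2
  · exact hp.coeff_eq_zero hdeg

/-- The 5-tuples of quadratic forms that are Heisenberg-invariant (cyclic condition (i)
and diagonal condition (ii)) are exactly the linear combinations of the three tuples
`(w_i²)`, `(w_{i+1}w_{i+4})`, `(w_{i+2}w_{i+3})`, and these form a 3-dimensional space
(the parametrisation is injective). -/
theorem heisenberg_invariant_quadrics
    (K : Type*) [Field K] (ζ : K) (hζ : IsPrimitiveRoot ζ 5) :
    {q : ZMod 5 → MvPolynomial (ZMod 5) K |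
        (∀ i, (q i).IsHomogeneous 2) ∧
        (∀ i, q (i + 1) = aeval (fun t : ZMod 5 => X (t + 1)) (q i)) ∧
        (∀ i, aeval (fun t : ZMod 5 => C (ζ ^ t.val) * X t) (q i) =
          C (ζ ^ ((2 * i : ZMod 5)).val) * q i)} =
      {q | ∃ r s t : K, q = fun i =>
        C r * X i ^ 2 + C s * (X (i + 1) * X (i + 4)) + C t * (X (i + 2) * X (i + 3))} ∧
    Function.Injective fun rst : K × K × K => fun i : ZMod 5 =>
      C rst.1 * X i ^ 2 + C rst.2.1 * (X (i + 1) * X (i + 4)) +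
        C rst.2.2 * (X (i + 2) * X (i + 3)) := by
  constructor
  · ext q
    constructor
    · rintro ⟨hh, hs, hd⟩
      refine ⟨coeff (Finsupp.single 0 1 + Finsupp.single 0 1) (q 0),
        coeff (Finsupp.single 1 1 + Finsupp.single 4 1) (q 0),
        coeff (Finsupp.single 2 1 + Finsupp.single 3 1) (q 0), ?_⟩
      generalize hr : coeff (Finsupp.single 0 1 + Finsupp.single 0 1) (q 0) = r
      generalize hs' : coeff (Finsupp.single 1 1 + Finsupp.single 4 1) (q 0) = s
      generalize ht : coeff (Finsupp.single 2 1 + Finsupp.single 3 1) (q 0) = t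
      change q = hiqF r s t
      obtain ⟨c0, c1, c2⟩ := hiq_coeffs r s t
      have base : q 0 = hiqF r s t 0 := by
        rw [← sub_eq_zero]
        refine hiq_zero ζ hζ _ ((hh 0).sub (hiq_hom r s t 0)) ?_ ?_ ?_ ?_
        · rw [map_sub, hd 0, hiq_diag ζ hζ]
          simp
        · rw [coeff_sub, hr, c0, sub_self]
        · rw [coeff_sub, hs', c1, sub_self]
        · rw [coeff_sub, ht, c2, sub_self]
      have all : ∀ n : ℕ, q (n : ZMod 5) = hiqF r s t (n : ZMod 5) := by
        intro n
        induction n with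
        | zero => simpa using base
        | succ n ih => rw [Nat.cast_succ, hs, ih, hiq_shift]
      funext i
      simpa using all i.val
    · rintro ⟨r, s, t, rfl⟩
      exact ⟨hiq_hom r s t, hiq_shift r s t, hiq_diag ζ hζ r s t⟩
  · rintro ⟨r, s, t⟩ ⟨r', s', t'⟩ h
    have h0 : hiqF r s t 0 = hiqF r' s' t' 0 := congrFun h 0
    obtain ⟨c0, c1, c2⟩ := hiq_coeffs r s t
    obtain ⟨d0, d1, d2⟩ := hiq_coeffs r' s' t'
    rw [h0] at c0 c1 c2
    rw [← c0, ← c1, ← c2, d0, d1, d2]
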